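/- Let n > 4. Then all surjective group homomorphisms σ : A(Δ_n) → Sym(n) are equivalent; that is, for any two surjective homomorphisms σ_1, σ_2 : A(Δ_n) → Sym(n) there is an automorphism α of Sym(n) with α(σ_1(g)) = σ_2(g) for all g ∈ A(Δ_n) (equivalently, σ_1 and σ_2 have the same kernel). In particular, every surjective homomorphism A(Δ_n) → Sym(n) is equivalent to the homomorphism σ with σ(a_i) = (i, i+1) for 1 ≤ i ≤ n−1 and σ(a_n) = (1, n). -/

import Mathlib

/- Scaffolding: braid/commuting predicates, ordered products, cycle and twisted
cycle commutators, and the Artin groups of the diagrams `Δ_n`, `Δ_{t,n}`, `D_n`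
(generators numbered `1, …, n` as in the paper, realized on the index type `Fin n`). -/

namespace ArtinPaper

open scoped commutatorElement

/-- `BR u v` : `u` and `v` braid, i.e. `u v u = v u v`. -/
def BR {G : Type*} [Group G] (u v : G) : Prop := u * v * u = v * u * v

/-- `CM u v` : `u` and `v` commute, i.e. `u v = v u`. -/
def CM {G : Type*} [Group G] (u v : G) : Prop := u * v = v * u

/-- `mulIcc y a b = y a * y (a+1) * ⋯ * y b` (equal to `1` when `a > b`). -/
def mulIcc {M : Type*} [Monoid M] (y : ℕ → M) (a b : ℕ) : M :=
  ((List.range (b + 1 - a)).map fun i => y (a + i)).prod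

/-- The cycle commutator
`cc(y₁,…,yₙ) = [y₁, y₂ ⋯ y_{n-1} yₙ y_{n-1}⁻¹ ⋯ y₂⁻¹]`. -/
def cc {G : Type*} [Group G] (y : ℕ → G) (n : ℕ) : G :=
  ⁅y 1, mulIcc y 2 (n - 1) * y n * (mulIcc y 2 (n - 1))⁻¹⁆

/-- The `t`-twisted cycle commutator
`tc_t(y₁,…,yₙ) = [y₁, y₂⁻¹ ⋯ y_{t+1}⁻¹ y_{t+2} ⋯ y_{n-1} yₙ y_{n-1}⁻¹ ⋯ y_{t+2}⁻¹ y_{t+1} ⋯ y₂]`.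
(The twisted cycle commutator `tc(y₁,y₂,y₃,y₄)` is `tc y 4 1`.) -/
def tc {G : Type*} [Group G] (y : ℕ → G) (n t : ℕ) : G :=
  ⁅y 1, mulIcc (fun i => (y i)⁻¹) 2 (t + 1) *
      (mulIcc y (t + 2) (n - 1) * y n * (mulIcc y (t + 2) (n - 1))⁻¹) *
      (mulIcc (fun i => (y i)⁻¹) 2 (t + 1))⁻¹⁆

/-- The `i`-th generator (numbered `1, …, n`) of the free group on `Fin n`. -/
def gen (n i : ℕ) : FreeGroup (Fin n) :=
  if h : 0 < n then FreeGroup.of ⟨(i - 1) % n, Nat.mod_lt _ h⟩ else 1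

/-- The braid relator `u v u (v u v)⁻¹`. -/
def braidRel {G : Type*} [Group G] (u v : G) : G := u * v * u * (v * u * v)⁻¹

/-- Artin-type relations on generators `1, …, n` determined by an edge predicate `E`:
generators joined by an edge braid, all other pairs of generators commute. -/
def relsOf (n : ℕ) (E : ℕ → ℕ → Prop) : Set (FreeGroup (Fin n)) :=
  { w | ∃ i j, 1 ≤ i ∧ i < j ∧ j ≤ n ∧
      ((E i j ∧ w = braidRel (gen n i) (gen n j)) ∨
       (¬ E i j ∧ w = ⁅gen n i, gen n j⁆)) }

/-- Edges of the `n`-cycle `Δ_n`: `{i, i+1}` for `1 ≤ i ≤ n-1`, and `{1, n}`. -/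
def cycEdge (n i j : ℕ) : Prop := (1 ≤ i ∧ i + 1 ≤ n ∧ j = i + 1) ∨ (i = 1 ∧ j = n)

/-- Defining relations of the Artin group `A(Δ_n)` of the `n`-cycle. -/
def cycleRels (n : ℕ) : Set (FreeGroup (Fin n)) := relsOf n (cycEdge n)

/-- Edges of the diagram `Δ_{t,n}`, where `r = n - 3 - t` and the generators are
`b_1, …, b_{4+r}` (vertices `1, …, 4+r`) and `c_{5+r}, …, c_n` (vertices `5+r, …, n`):
the braiding pairs are `{b_1,b_2}, {b_2,b_3}, {b_3,b_1}, {b_4,b_1}, {b_1,b_5}`,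
`{b_i,b_{i+1}}` for `5 ≤ i ≤ 3+r`, `{b_3,c_{5+r}}`, and `{c_i,c_{i+1}}` for
`5+r ≤ i ≤ n-1`. -/
def deltaEdge (n t i j : ℕ) : Prop :=
  (i = 1 ∧ j = 2) ∨ (i = 2 ∧ j = 3) ∨ (i = 1 ∧ j = 3) ∨ (i = 1 ∧ j = 4) ∨
  (i = 1 ∧ j = 5 ∧ 5 ≤ 4 + (n - 3 - t)) ∨
  (5 ≤ i ∧ i + 1 ≤ 4 + (n - 3 - t) ∧ j = i + 1) ∨
  (i = 3 ∧ j = 5 + (n - 3 - t) ∧ 5 + (n - 3 - t) ≤ n) ∨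
  (5 + (n - 3 - t) ≤ i ∧ i + 1 ≤ n ∧ j = i + 1)

/-- Defining relations of the Artin group `A(Δ_{t,n})`. -/
def deltaRels (n t : ℕ) : Set (FreeGroup (Fin n)) := relsOf n (deltaEdge n t)

/-- Edges of the Coxeter diagram `D_n`: `{1,3}, {2,3}`, and `{i, i+1}` for
`3 ≤ i ≤ n-1` (in particular `1` and `2` are not joined, so `x_1 x_2 = x_2 x_1`). -/
def dEdge (n i j : ℕ) : Prop :=
  (i = 1 ∧ j = 3) ∨ (i = 2 ∧ j = 3) ∨ (3 ≤ i ∧ i + 1 ≤ n ∧ j = i + 1)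

/-- Defining relations of the Artin group `A(D_n)` of type `D_n`. -/
def dRels (n : ℕ) : Set (FreeGroup (Fin n)) := relsOf n (dEdge n)

/-- The Artin group `A(D_n)` of type `D_n`. -/
abbrev ArtinD (n : ℕ) := PresentedGroup (dRels n)

/-- `G_{n,t}`: the quotient of `A(Δ_n)` by the normal closure of the `t`-twisted
cycle commutator `tc_t(a_1, …, a_n)`. -/
abbrev Gnt (n t : ℕ) := PresentedGroup (cycleRels n ∪ {tc (gen n) n t})

/-- `Q_{n,t}`: the quotient of `A(Δ_{t,n})` by the normal closure of the twisted
cycle commutator `tc(b_1, b_2, b_3, b_4)`. -/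
abbrev Qnt (n t : ℕ) := PresentedGroup (deltaRels n t ∪ {tc (gen n) 4 1})

open Equiv Equiv.Perm

/-- Two elements that braid and commute are equal. -/
theorem BR.eq_of_commute {G : Type*} [Group G] {u v : G} (hb : BR u v) (hc : Commute u v) :
    u = v := by
  unfold BR at hb
  rw [hc.eq, mul_assoc, mul_assoc] at hb
  exact mul_left_cancel (mul_left_cancel hb)

theorem BR.symm {G : Type*} [Group G] {u v : G} (hb : BR u v) : BR v u := Eq.symm hb

theorem BR.map {G H : Type*} [Group G] [Group H] (f : G →* H) {u v : G} (hb : BR u v) :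
    BR (f u) (f v) := by
  have := congrArg f hb
  simpa [BR] using this

/-- Elements that braid are conjugate. -/
theorem BR.isConj {G : Type*} [Group G] {u v : G} (hb : BR u v) : IsConj u v := by
  rw [isConj_iff]
  refine ⟨u * v, ?_⟩
  rw [mul_inv_eq_iff_eq_mul, ← mul_assoc]
  exact hb

/-- `y 0, …, y (m - 1)` satisfy the relations of the standard generators of the braid group
on `m + 1` strands. -/
structure BraidChain {G : Type*} [Group G] (m : ℕ) (y : ℕ → G) : Prop where
  braid : ∀ i, i + 1 < m → BR (y i) (y (i + 1))
  commute : ∀ i j, i + 2 ≤ j → j < m → Commute (y i) (y j)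

namespace BraidChain

variable {G : Type*} [Group G] {m : ℕ} {y : ℕ → G}

theorem map {H : Type*} [Group H] (f : G →* H) (h : BraidChain m y) :
    BraidChain m (fun i => f (y i)) :=
  ⟨fun i hi => (h.braid i hi).map f, fun i j hi hj => (h.commute i j hi hj).map f⟩

theorem shift (h : BraidChain m y) (a b : ℕ) (hab : b + a ≤ m) :
    BraidChain b (fun i => y (i + a)) :=
  ⟨fun i hi => by simpa [add_right_comm] using h.braid (i + a) (by omega),
    fun i j hi hj => h.commute _ _ (by omega) (by omega)⟩

/-- If two consecutive members of a braid chain coincide, the chain is constant. -/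
theorem eq_zero_of_eq_succ (h : BraidChain m y) {i : ℕ} (hi : i + 1 < m)
    (heq : y i = y (i + 1)) : ∀ j, j < m → y j = y 0 := by
  have up : ∀ j, i ≤ j → j + 1 < m → y j = y (j + 1) := by
    intro j hij
    induction j, hij using Nat.le_induction with
    | base => intro _; exact heq
    | succ j hij ih =>
      intro hj
      have e := ih (by omega)
      exact (h.braid _ hj).eq_of_commute (e ▸ h.commute j (j + 1 + 1) (by omega) hj)
  have down : ∀ d j, j + d = i → y j = y (j + 1) := by
    intro d
    induction d with
    | zero => intro j hj; obtain rfl : j = i := by omega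
              exact heq
    | succ d ih =>
      intro j hj
      have e := ih (j + 1) (by omega)
      refine (h.braid j (by omega)).eq_of_commute ?_
      rw [e]
      exact h.commute j (j + 1 + 1) (by omega) (by omega)
  intro j
  induction j with
  | zero => intro _; rfl
  | succ j ih =>
    intro hj
    rw [← ih (by omega)]
    rcases le_total i j with hij | hij
    · exact (up j hij hj).symm
    · exact (down (i - j) j (by omega)).symm

theorem isConj_zero (h : BraidChain m y) : ∀ j, j < m → IsConj (y 0) (y j) := by
  intro j
  induction j with
  | zero => intro _; exact IsConj.refl _
  | succ j ih => intro hj; exact (ih (by omega)).trans (h.braid j hj).isConj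

end BraidChain

section Centralizer

variable {S : Type*} [Fintype S] [DecidableEq S]

/-- Permutations commuting with `x` and stabilizing each cycle of `x` commute on the support
of `x`. -/
theorem mul_apply_comm_of_conj_cycle_eq {x a b : Perm S} (ha : Commute x a) (hb : Commute x b)
    (hac : ∀ c ∈ x.cycleFactorsFinset, a * c * a⁻¹ = c)
    (hbc : ∀ c ∈ x.cycleFactorsFinset, b * c * b⁻¹ = c) {p : S} (hp : x p ≠ p) :
    (a * b) p = (b * a) p := by
  have key : ∀ d : Perm S, (∀ c ∈ x.cycleFactorsFinset, d * c * d⁻¹ = c) →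
      ∃ i : ℤ, (x ^ i) p = d p := by
    intro d hd
    have h1 := hd (x.cycleOf p) (cycleOf_mem_cycleFactorsFinset_iff.2 (mem_support.2 hp))
    have h2 : d p ∈ (d * x.cycleOf p * d⁻¹).support := by
      rw [support_conj]
      refine Finset.mem_map_of_mem _ ?_
      rw [mem_support_cycleOf_iff]
      exact ⟨SameCycle.refl _ _, mem_support.2 hp⟩
    rw [h1, mem_support_cycleOf_iff] at h2
    exact h2.1
  obtain ⟨i, hi⟩ := key a hac
  obtain ⟨j, hj⟩ := key b hbc
  have e1 : a ((x ^ j) p) = (x ^ j) (a p) := by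
    rw [← mul_apply, ← mul_apply, (ha.zpow_left j).eq]
  have e2 : b ((x ^ i) p) = (x ^ i) (b p) := by
    rw [← mul_apply, ← mul_apply, (hb.zpow_left i).eq]
  rw [mul_apply, mul_apply, ← hj, ← hi, e1, e2, ← hi, ← hj, ← mul_apply, ← mul_apply,
    ← zpow_add, ← zpow_add, add_comm]

theorem commute_apply_fixed_iff {T : Type*} {x a : Perm T} (ha : Commute x a) (p : T) :
    x (a p) = a p ↔ x p = p := by
  rw [← mul_apply, ha.eq, mul_apply, a.injective.eq_iff]

/-- The action of the centralizer of `x` on the fixed points of `x`. -/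
def centralizerFixed (x : Perm S) :
    Subgroup.centralizer {x} →* Perm {p : S // x p = p} where
  toFun a := (a : Perm S).subtypePerm
    (fun p => commute_apply_fixed_iff (Subgroup.mem_centralizer_singleton_iff.1 a.2).symm p)
  map_one' := by ext; simp
  map_mul' a b := by ext; rfl

theorem card_fixed_add_card_support (x : Perm S) :
    Fintype.card {p : S // x p = p} + x.support.card = Fintype.card S := by
  have h : x.supportᶜ.card = Fintype.card {p : S // x p = p} := by
    rw [Fintype.card_subtype]
    congr 1
    ext p
    simp
  rw [← h, add_comm]
  exact Finset.card_add_card_compl _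

theorem two_mul_card_cycleFactorsFinset_le (x : Perm S) :
    2 * x.cycleFactorsFinset.card ≤ x.support.card := by
  rw [← sum_cycleType, ← Finset.card_val, ← Multiset.card_map (Finset.card ∘ support),
    ← cycleType_def, mul_comm]
  simpa using Multiset.card_nsmul_le_sum (s := x.cycleType) (fun _ => two_le_of_mem_cycleType)

end Centralizer

section SmallCases

variable {S : Type*} [Fintype S] [DecidableEq S]

theorem commute_of_card_le_two {T : Type*} [Fintype T] (hT : Fintype.card T ≤ 2)
    (f g : Perm T) : Commute f g := by
  obtain ⟨ι⟩ : Nonempty (T ↪ Fin 2) :=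
    Function.Embedding.nonempty_of_card_le (by simpa using hT)
  have h : ∀ f g : Perm (Fin 2), f * g = g * f := by decide
  apply viaEmbeddingHom_injective ι
  rw [map_mul, map_mul]
  exact h _ _

/-- If the cycles of `x` have distinct lengths and `x` has at most two fixed points, the
centralizer of `x` is abelian. -/
theorem commute_of_nodup_cycleType {x y z : Perm S} (hy : Commute x y) (hz : Commute x z)
    (hx : x.cycleType.Nodup) (hF : Fintype.card {p : S // x p = p} ≤ 2) : Commute y z := by
  have key : ∀ d : Perm S, Commute x d → ∀ c ∈ x.cycleFactorsFinset, d * c * d⁻¹ = c := by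
    intro d hd c hc
    have hmem : d * c * d⁻¹ ∈ x.cycleFactorsFinset := by
      have := (mem_cycleFactorsFinset_conj x d c).2 hc
      rwa [← hd.eq, mul_inv_cancel_right] at this
    rw [cycleType_def] at hx
    refine Multiset.inj_on_of_nodup_map hx _ hmem _ hc ?_
    simp [support_conj]
  ext p
  by_cases hp : x p = p
  · let Y : Subgroup.centralizer {x} := ⟨y, Subgroup.mem_centralizer_singleton_iff.2 hy.eq.symm⟩
    let Z : Subgroup.centralizer {x} := ⟨z, Subgroup.mem_centralizer_singleton_iff.2 hz.eq.symm⟩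
    have := congrArg (fun f => f ⟨p, hp⟩)
      (commute_of_card_le_two hF (centralizerFixed x Y) (centralizerFixed x Z)).eq
    exact congrArg Subtype.val this
  · exact mul_apply_comm_of_conj_cycle_eq hy hz (key y hy) (key z hz) hp

theorem card_support_ge_three {x : Perm S} (h1 : x ≠ 1) (hx : ¬ x.IsSwap) :
    3 ≤ x.support.card := by
  have h := two_le_card_support_of_ne_one h1
  have : x.support.card ≠ 2 := fun e => hx (card_support_eq_two.1 e)
  omega

theorem braid_eq_of_double_swap :
    ∀ y : Perm (Fin 5), swap 0 1 * swap 2 3 * y = y * (swap 0 1 * swap 2 3) →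
    ∀ z : Perm (Fin 5), swap 0 1 * swap 2 3 * z = z * (swap 0 1 * swap 2 3) →
    y * z * y = z * y * z → y = z := by
  decide +kernel

/-- In a symmetric group of degree at most five, a nontrivial permutation commuting with two
distinct braiding permutations is a transposition (and the degree is five). -/
theorem isSwap_of_card_le_five (hS : Fintype.card S ≤ 5) {x y z : Perm S} (h1 : x ≠ 1)
    (hy : Commute x y) (hz : Commute x z) (hb : BR y z) (hne : y ≠ z) :
    x.IsSwap ∧ Fintype.card S = 5 := by
  have hcard := card_fixed_add_card_support x
  have hsum := sum_cycleType x
  by_cases hx : x.IsSwap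
  · refine ⟨hx, ?_⟩
    by_contra h5
    refine hne (hb.eq_of_commute (commute_of_nodup_cycleType hy hz ?_ ?_))
    · rw [hx.isCycle.cycleType]
      exact Multiset.nodup_singleton _
    · have := card_support_eq_two.2 hx
      omega
  exfalso
  have h3 := card_support_ge_three h1 hx
  apply hne
  by_cases hnd : x.cycleType.Nodup
  · exact hb.eq_of_commute (commute_of_nodup_cycleType hy hz hnd (by omega))
  have htype : x.cycleType = {2, 2} := by
    simp only [Multiset.nodup_iff_ne_cons_cons, not_forall, not_not] at hnd
    obtain ⟨a, t, ht⟩ := hnd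
    have ha : 2 ≤ a := two_le_of_mem_cycleType (σ := x) (by rw [ht]; simp)
    rw [ht, Multiset.sum_cons, Multiset.sum_cons] at hsum
    have ht0 : t = 0 := by
      by_contra h0
      obtain ⟨b, hbt⟩ := Multiset.exists_mem_of_ne_zero h0
      have hb2 : 2 ≤ b := two_le_of_mem_cycleType (σ := x) (by rw [ht]; simp [hbt])
      have := Multiset.single_le_sum (fun _ _ => Nat.zero_le _) b hbt
      omega
    subst ht0
    have ha2 : a = 2 := by simp at hsum; omega
    subst ha2
    exact ht
  obtain ⟨ι⟩ : Nonempty (S ↪ Fin 5) :=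
    Function.Embedding.nonempty_of_card_le (by simpa using hS)
  have hconj : IsConj (viaEmbeddingHom ι x) (swap 0 1 * swap 2 3) := by
    rw [isConj_iff_cycleType_eq]
    have e : (swap 0 1 * swap 2 3 : Perm (Fin 5)).cycleType = {2, 2} := by
      rw [Disjoint.cycleType_mul, (swap_isSwap_iff.2 _).isCycle.cycleType,
        (swap_isSwap_iff.2 _).isCycle.cycleType]
      · decide
      · decide
      · decide
      · rw [disjoint_iff_disjoint_support]
        decide
    rw [e, ← htype]
    convert cycleType_extendDomain (Equiv.ofInjective ι.1 ι.2) (g := x)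
    rw [viaEmbeddingHom_apply, viaEmbedding]
    congr!
  rw [isConj_iff] at hconj
  obtain ⟨c, hc⟩ := hconj
  let φ : Perm S →* Perm (Fin 5) := (MulAut.conj c).toMonoidHom.comp (viaEmbeddingHom ι)
  have hφ : Function.Injective φ := (MulAut.conj c).injective.comp (viaEmbeddingHom_injective ι)
  have hφx : φ x = swap 0 1 * swap 2 3 := hc
  apply hφ
  refine braid_eq_of_double_swap _ ?_ _ ?_ (hb.map φ)
  · rw [← hφx]; exact (hy.map φ).eq
  · rw [← hφx]; exact (hz.map φ).eq

end SmallCases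

section Swaps

variable {S : Type*} [DecidableEq S]

/-- Distinct commuting transpositions are disjoint. -/
theorem disjoint_of_isSwap_of_commute {f g : Perm S} (hf : f.IsSwap) (hg : g.IsSwap)
    (hc : Commute f g) (hne : f ≠ g) : Disjoint f g := by
  obtain ⟨a, b, hab, rfl⟩ := hf
  obtain ⟨c, d, hcd, rfl⟩ := hg
  have h : swap (swap a b c) (swap a b d) = swap c d := by
    have := mul_swap_eq_swap_mul (swap a b) c d
    rw [hc.eq] at this
    exact (mul_right_cancel this).symm
  have h2 := congrArg (fun f => f c) h
  have h3 := congrArg (fun f => f d) h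
  intro p
  simp only [swap_apply_def] at h2 h3 ⊢
  grind [swap_comm]

end Swaps

section BraidPerm

universe u

/-- A braid chain in the centralizer of `x` that acts as a constant chain both on the fixed
points and on the set of cycles of `x` is constant. -/
theorem BraidChain.const_of_centralizer {S : Type*} [Fintype S] [DecidableEq S] {x : Perm S}
    {m : ℕ} (hm : 4 ≤ m) {y : ℕ → Subgroup.centralizer {x}} (h : BraidChain m y)
    (hF : ∀ i, i < m → centralizerFixed x (y i) = centralizerFixed x (y 0))
    (hC : ∀ i, i < m → OnCycleFactors.toPermHom x (y i) = OnCycleFactors.toPermHom x (y 0)) :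
    ∀ j, j < m → y j = y 0 := by
  have hx : ∀ a : Subgroup.centralizer {x}, Commute x (a : Perm S) :=
    fun a => (Subgroup.mem_centralizer_singleton_iff.1 a.2).symm
  have hFix : ∀ i, i < m → ∀ p, x p = p → ((y i * (y 0)⁻¹ : Subgroup.centralizer {x}) :
      Perm S) p = p := by
    intro i hi p hp
    have e : centralizerFixed x (y i * (y 0)⁻¹) = 1 := by
      rw [map_mul, map_inv, hF i hi, mul_inv_cancel]
    exact congrArg Subtype.val (congrArg (fun f => f ⟨p, hp⟩) e)
  have hCyc : ∀ i, i < m → ∀ c ∈ x.cycleFactorsFinset,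
      ((y i * (y 0)⁻¹ : Subgroup.centralizer {x}) : Perm S) * c *
      ((y i * (y 0)⁻¹ : Subgroup.centralizer {x}) : Perm S)⁻¹ = c := by
    intro i hi c hc
    have e : OnCycleFactors.toPermHom x (y i * (y 0)⁻¹) = 1 := by
      rw [map_mul, map_inv, hC i hi, mul_inv_cancel]
    have := OnCycleFactors.coe_toPermHom x (y i * (y 0)⁻¹) ⟨c, hc⟩
    rw [e] at this
    exact this.symm
  have hcomm : Commute (y 2 * (y 0)⁻¹) (y 3 * (y 0)⁻¹) := by
    apply Subtype.ext
    ext p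
    by_cases hp : x p = p
    · change ((y 2 * (y 0)⁻¹ : Subgroup.centralizer {x}) : Perm S)
          (((y 3 * (y 0)⁻¹ : Subgroup.centralizer {x}) : Perm S) p) =
        ((y 3 * (y 0)⁻¹ : Subgroup.centralizer {x}) : Perm S)
          (((y 2 * (y 0)⁻¹ : Subgroup.centralizer {x}) : Perm S) p)
      rw [hFix 3 (by omega) p hp, hFix 2 (by omega) p hp, hFix 3 (by omega) p hp]
    · exact mul_apply_comm_of_conj_cycle_eq (hx _) (hx _) (hCyc 2 (by omega))
        (hCyc 3 (by omega)) hp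
  have h02 := h.commute 0 2 (by omega) (by omega)
  have h03 := h.commute 0 3 (by omega) (by omega)
  have h1 : Commute (y 2 * (y 0)⁻¹) (y 3) := by
    have := hcomm.mul_right (h02.symm.mul_left (Commute.refl (y 0)).inv_left)
    rwa [inv_mul_cancel_right] at this
  have h2 : Commute (y 2) (y 3) := by
    have := h1.mul_left h03
    rwa [inv_mul_cancel_right] at this
  exact h.eq_zero_of_eq_succ (by omega) ((h.braid 2 (by omega)).eq_of_commute h2)

/-- Assuming that braid chains of length `m` in symmetric groups of degree at most `m` are
constant, so are those centralizing a permutation with few fixed points and few cycles. -/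
theorem BraidChain.const_of_commute {m : ℕ} (hm : 4 ≤ m)
    (IH : ∀ (T : Type u) [Fintype T] [DecidableEq T] (f : ℕ → Perm T), Fintype.card T ≤ m →
      BraidChain m f → ∀ j, j < m → f j = f 0)
    {S : Type u} [Fintype S] [DecidableEq S] {x : Perm S} {y : ℕ → Perm S}
    (h : BraidChain m y) (hx : ∀ i, i < m → Commute x (y i))
    (hF : Fintype.card {p : S // x p = p} ≤ m) (hS : Fintype.card S ≤ 2 * m + 1) :
    ∀ j, j < m → y j = y 0 := by
  let z : ℕ → Subgroup.centralizer {x} := fun i =>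
    if hi : i < m then ⟨y i, Subgroup.mem_centralizer_singleton_iff.2 (hx i hi).eq.symm⟩ else 1
  have hz : ∀ i, i < m → (z i : Perm S) = y i := fun i hi => by simp [z, hi]
  have hch : BraidChain m z := by
    refine ⟨fun i hi => ?_, fun i j hi hj => ?_⟩
    · apply Subtype.ext
      simp only [Subgroup.coe_mul, hz i (by omega), hz (i + 1) hi]
      exact h.braid i hi
    · apply Subtype.ext
      simp only [Subgroup.coe_mul, hz i (by omega), hz j hj]
      exact h.commute i j hi hj
  have hcyc : Fintype.card x.cycleFactorsFinset ≤ m := by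
    rw [Fintype.card_coe]
    have := two_mul_card_cycleFactorsFinset_le x
    have := Finset.card_le_univ x.support
    omega
  intro j hj
  rw [← hz j hj, ← hz 0 (by omega), hch.const_of_centralizer hm (IH _ _ hF (hch.map _))
    (IH _ _ hcyc (hch.map _)) j hj]

/-- For `m ≥ 4`, all homomorphisms from the braid group on `m + 1` strands to a symmetric group
of degree at most `m` are cyclic. -/
theorem BraidChain.const_of_card_le (m : ℕ) (hm : 4 ≤ m) :
    ∀ (S : Type u) [Fintype S] [DecidableEq S] (y : ℕ → Perm S), Fintype.card S ≤ m →
      BraidChain m y → ∀ j, j < m → y j = y 0 := by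
  induction m using Nat.strong_induction_on with
  | _ m ih =>
  intro S _ _ y hS h
  have h01 := h.braid 0 (by omega)
  by_cases h1 : y 0 = 1
  · refine h.eq_zero_of_eq_succ (i := 0) (by omega) (h01.eq_of_commute ?_)
    rw [h1]
    exact Commute.one_left _
  have hcomm : ∀ i, i + 2 < m → Commute (y 0) (y (i + 2)) := fun i hi =>
    h.commute 0 (i + 2) (by omega) hi
  by_cases hm6 : 6 ≤ m
  · have hcard := card_fixed_add_card_support (y 0)
    have hsupp := two_le_card_support_of_ne_one h1
    have := (h.shift 2 (m - 2) (by omega)).const_of_commute (x := y 0) (by omega)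
      (ih (m - 2) (by omega) (by omega)) (fun i hi => hcomm i (by omega)) (by omega) (by omega)
      1 (by omega)
    exact h.eq_zero_of_eq_succ (i := 2) (by omega) this.symm
  by_contra hcon
  have hne : y 2 ≠ y 3 := fun e => hcon (h.eq_zero_of_eq_succ (i := 2) (by omega) e)
  obtain ⟨hswap, h5⟩ := isSwap_of_card_le_five (by omega) h1 (hcomm 0 (by omega))
    (hcomm 1 (by omega)) (h.braid 2 (by omega)) hne
  have hsupp : ∀ j, j < m → (y j).support.card = 2 := by
    intro j hj
    rw [← sum_cycleType, ← isConj_iff_cycleType_eq.1 (h.isConj_zero j hj), sum_cycleType]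
    exact card_support_eq_two.2 hswap
  have hsw : ∀ j, j < m → (y j).IsSwap := fun j hj => card_support_eq_two.1 (hsupp j hj)
  have hm5 : m = 5 := by omega
  subst hm5
  have b1 := h.braid 1 (by omega)
  have b2 := h.braid 2 (by omega)
  have b3 := h.braid 3 (by omega)
  have d02 : Disjoint (y 0) (y 2) :=
    disjoint_of_isSwap_of_commute (hsw 0 (by omega)) (hsw 2 (by omega)) (hcomm 0 (by omega)) (fun e =>
      hne (b2.eq_of_commute (e ▸ hcomm 1 (by omega))))
  have d04 : Disjoint (y 0) (y 4) :=
    disjoint_of_isSwap_of_commute (hsw 0 (by omega)) (hsw 4 (by omega)) (hcomm 2 (by omega)) (fun e =>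
      hcon (h.eq_zero_of_eq_succ (i := 3) (by omega)
        (b3.eq_of_commute (e ▸ (hcomm 1 (by omega)).symm))))
  have d24 : Disjoint (y 2) (y 4) :=
    disjoint_of_isSwap_of_commute (hsw 2 (by omega)) (hsw 4 (by omega))
      (h.commute 2 4 (by omega) (by omega)) (fun e =>
      hcon (h.eq_zero_of_eq_succ (i := 1) (by omega)
        (b1.eq_of_commute (e ▸ h.commute 1 4 (by omega) (by omega)))))
  have hle := Finset.card_le_univ (y 0 * y 2 * y 4).support
  rw [(d04.mul_left d24).card_support_mul, d02.card_support_mul, hsupp 0 (by omega),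
    hsupp 2 (by omega), hsupp 4 (by omega)] at hle
  omega

end BraidPerm

section OuterAutomorphism

/-- The permutation `(a b)(c d)(e f)`. -/
def tripleSwap (a b c d e f : Fin 6) : Perm (Fin 6) := swap a b * swap c d * swap e f

/-- The six synthematic totals: partitions of the edges of the complete graph on `Fin 6` into
five perfect matchings, each matching being viewed as a product of three transpositions. -/
def total : Fin 6 → Finset (Perm (Fin 6)) :=
  ![{tripleSwap 0 1 2 3 4 5, tripleSwap 0 2 1 4 3 5, tripleSwap 0 3 1 5 2 4,
      tripleSwap 0 4 1 3 2 5, tripleSwap 0 5 1 2 3 4},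
    {tripleSwap 0 1 2 3 4 5, tripleSwap 0 2 1 5 3 4, tripleSwap 0 3 1 4 2 5,
      tripleSwap 0 4 1 2 3 5, tripleSwap 0 5 1 3 2 4},
    {tripleSwap 0 1 2 4 3 5, tripleSwap 0 2 1 3 4 5, tripleSwap 0 3 1 4 2 5,
      tripleSwap 0 4 1 5 2 3, tripleSwap 0 5 1 2 3 4},
    {tripleSwap 0 1 2 4 3 5, tripleSwap 0 2 1 5 3 4, tripleSwap 0 3 1 2 4 5,
      tripleSwap 0 4 1 3 2 5, tripleSwap 0 5 1 4 2 3},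
    {tripleSwap 0 1 2 5 3 4, tripleSwap 0 2 1 3 4 5, tripleSwap 0 3 1 5 2 4,
      tripleSwap 0 4 1 2 3 5, tripleSwap 0 5 1 4 2 3},
    {tripleSwap 0 1 2 5 3 4, tripleSwap 0 2 1 4 3 5, tripleSwap 0 3 1 2 4 5,
      tripleSwap 0 4 1 5 2 3, tripleSwap 0 5 1 3 2 4}]

/-- Conjugation of a set of permutations. -/
def conjSet (g : Perm (Fin 6)) (s : Finset (Perm (Fin 6))) : Finset (Perm (Fin 6)) :=
  s.image fun h => g * h * g⁻¹

theorem conjSet_one (s : Finset (Perm (Fin 6))) : conjSet 1 s = s := by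
  simp [conjSet]

theorem conjSet_mul (g h : Perm (Fin 6)) (s : Finset (Perm (Fin 6))) :
    conjSet (g * h) s = conjSet g (conjSet h s) := by
  simp [conjSet, Finset.image_image, Function.comp_def, mul_assoc]

theorem total_injective : Function.Injective total := by
  unfold Function.Injective
  decide +kernel

theorem exists_conjSet_swap_total :
    ∀ k : Fin 5, ∀ i, ∃ j, conjSet (swap k.castSucc k.succ) (total i) = total j := by
  decide +kernel

/-- Matchings whose conjugation actions on the totals are the adjacent transpositions. -/
def adjacentPreimage : Fin 5 → Perm (Fin 6) :=
  ![tripleSwap 0 1 2 3 4 5, tripleSwap 0 3 1 4 2 5, tripleSwap 0 1 2 4 3 5,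
    tripleSwap 0 5 1 4 2 3, tripleSwap 0 1 2 5 3 4]

theorem conjSet_adjacentPreimage :
    ∀ k : Fin 5, ∀ i, conjSet (adjacentPreimage k) (total i) =
      total (swap k.castSucc k.succ i) := by
  decide +kernel

theorem exists_conjSet_total (g : Perm (Fin 6)) : ∀ i, ∃ j, conjSet g (total i) = total j := by
  have hg : g ∈ Submonoid.closure (Set.range fun k : Fin 5 => swap k.castSucc k.succ) := by
    rw [mclosure_swap_castSucc_succ]
    trivial
  induction hg using Submonoid.closure_induction with
  | mem x hx =>
    obtain ⟨k, rfl⟩ := hx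
    exact exists_conjSet_swap_total k
  | one => exact fun i => ⟨i, conjSet_one _⟩
  | mul x y _ _ ihx ihy =>
    intro i
    obtain ⟨j, hj⟩ := ihy i
    obtain ⟨l, hl⟩ := ihx j
    exact ⟨l, by rw [conjSet_mul, hj, hl]⟩

/-- There is an automorphism of `Sym(6)` taking products of three disjoint transpositions to
transpositions. -/
theorem exists_outer_automorphism :
    ∃ θ : Perm (Fin 6) ≃* Perm (Fin 6),
      ∀ x : Perm (Fin 6), x.cycleType = {2, 2, 2} → (θ x).IsSwap := by
  choose f hf using exists_conjSet_total
  let F : Perm (Fin 6) →* Function.End (Fin 6) :=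
    { toFun := f
      map_one' := by
        funext i
        apply total_injective
        rw [← hf, conjSet_one]
        rfl
      map_mul' := fun g h => by
        funext i
        apply total_injective
        rw [← hf, conjSet_mul, hf, hf]
        rfl }
  let φ : Perm (Fin 6) →* Perm (Fin 6) := F.toHomPerm
  have hφ : ∀ k : Fin 5, φ (adjacentPreimage k) = swap k.castSucc k.succ := by
    intro k
    ext1 i
    apply total_injective
    rw [← conjSet_adjacentPreimage, hf]
    rfl
  have hsurj : Function.Surjective φ := by
    rw [← MonoidHom.mrange_eq_top, ← top_le_iff, ← mclosure_swap_castSucc_succ,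
      Submonoid.closure_le]
    rintro _ ⟨k, rfl⟩
    exact ⟨_, hφ k⟩
  refine ⟨MulEquiv.ofBijective φ ⟨Finite.injective_iff_surjective.2 hsurj, hsurj⟩, fun x hx => ?_⟩
  have hT : (adjacentPreimage 0).cycleType = {2, 2, 2} := by
    change (swap 0 1 * swap 2 3 * swap 4 5 : Perm (Fin 6)).cycleType = {2, 2, 2}
    rw [Disjoint.cycleType_mul, Disjoint.cycleType_mul, (swap_isSwap_iff.2 _).isCycle.cycleType,
      (swap_isSwap_iff.2 _).isCycle.cycleType, (swap_isSwap_iff.2 _).isCycle.cycleType]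
    · decide
    · decide
    · decide
    · decide
    · rw [disjoint_iff_disjoint_support]
      decide
    · rw [disjoint_iff_disjoint_support]
      decide
  have hconj : IsConj (adjacentPreimage 0) x := isConj_iff_cycleType_eq.2 (hT.trans hx.symm)
  have hconj' : IsConj (φ (adjacentPreimage 0)) (φ x) := φ.map_isConj hconj
  rw [hφ, isConj_iff_cycleType_eq] at hconj'
  change (φ x).IsSwap
  rw [← card_support_eq_two, ← sum_cycleType, ← hconj', sum_cycleType, card_support_eq_two]
  exact ⟨_, _, by decide, rfl⟩

/-- An odd permutation of six points commuting with two distinct braiding permutations is a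
transposition or a product of three disjoint transpositions. -/
theorem isSwap_or_cycleType_of_sign {x y z : Perm (Fin 6)} (hs : sign x = -1)
    (hy : Commute x y) (hz : Commute x z) (hb : BR y z) (hne : y ≠ z) :
    x.IsSwap ∨ x.cycleType = {2, 2, 2} := by
  by_contra! hcon
  obtain ⟨hx, hT⟩ := hcon
  have h1 : x ≠ 1 := by
    rintro rfl
    simp at hs
  have hcard := card_fixed_add_card_support x
  have hsum := sum_cycleType x
  rw [Fintype.card_fin] at hcard
  have h3 := card_support_ge_three h1 hx
  have h3' : x.support.card ≠ 3 := by
    intro e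
    rw [(card_support_eq_three_iff.1 e).sign] at hs
    exact absurd hs (by decide)
  have hnd : ¬ x.cycleType.Nodup := fun hnd =>
    hne (hb.eq_of_commute (commute_of_nodup_cycleType hy hz hnd (by omega)))
  simp only [Multiset.nodup_iff_ne_cons_cons, not_forall, not_not] at hnd
  obtain ⟨a, t, ht⟩ := hnd
  rw [sign_of_cycleType] at hs
  have h2 : ∀ b ∈ x.cycleType, 2 ≤ b := fun b => two_le_of_mem_cycleType
  rw [ht] at hs hsum h2 hT
  have ha := h2 a (by simp)
  rw [Multiset.sum_cons, Multiset.sum_cons] at hsum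
  rcases Multiset.empty_or_exists_mem t with rfl | ⟨b, hbt⟩
  · simp only [Multiset.sum_cons, Multiset.card_cons, Multiset.sum_zero, Multiset.card_zero] at hs
    rw [Even.neg_one_pow ⟨a + 1, by ring⟩] at hs
    exact absurd hs (by decide)
  · obtain ⟨s, rfl⟩ := Multiset.exists_cons_of_mem hbt
    have hb := h2 b (by simp)
    rw [Multiset.sum_cons] at hsum
    rcases Multiset.empty_or_exists_mem s with rfl | ⟨c, hcs⟩
    · simp only [Multiset.sum_zero] at hsum
      obtain rfl : a = 2 := by omega
      obtain rfl : b = 2 := by omega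
      exact hT rfl
    · have hc := h2 c (by simp [hcs])
      have := Multiset.single_le_sum (fun _ _ => Nat.zero_le _) c hcs
      omega

end OuterAutomorphism

/-- `X` is an `n`-periodic generating sequence of `G` satisfying the defining relations of the
Artin group of the `n`-cycle. -/
structure BraidCycle {G : Type*} [Group G] (n : ℕ) (X : ℕ → G) : Prop where
  periodic : ∀ k, X (k + n) = X k
  braid : ∀ k, BR (X k) (X (k + 1))
  commute : ∀ k j, 2 ≤ j → j + 2 ≤ n → Commute (X k) (X (k + j))
  closure_range : Subgroup.closure (Set.range X) = ⊤

namespace BraidCycle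

section Group

variable {G : Type*} [Group G] {n : ℕ} {X : ℕ → G}

theorem map {H : Type*} [Group H] (h : BraidCycle n X) (f : G ≃* H) :
    BraidCycle n (fun k => f (X k)) where
  periodic k := congrArg f (h.periodic k)
  braid k := (h.braid k).map f.toMonoidHom
  commute k j h2 hj := (h.commute k j h2 hj).map f
  closure_range := by
    have := congrArg (Subgroup.map f.toMonoidHom) h.closure_range
    rw [MonoidHom.map_closure, Subgroup.map_top_of_surjective _ f.surjective,
      ← Set.range_comp] at this
    exact this

theorem chain (h : BraidCycle n X) (hn : 3 ≤ n) (k : ℕ) :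
    BraidChain (n - 1) (fun i => X (i + k)) where
  braid i _ := by simpa [add_right_comm] using h.braid (i + k)
  commute i j hi hj := by
    have := h.commute (i + k) (j - i) (by omega) (by omega)
    rwa [show i + k + (j - i) = j + k by omega] at this

theorem isConj_zero (h : BraidCycle n X) : ∀ k, IsConj (X 0) (X k) := by
  intro k
  induction k with
  | zero => exact IsConj.refl _
  | succ k ih => exact ih.trans (h.braid k).isConj

theorem ne_succ (h : BraidCycle n X) (hn : 4 ≤ n) {a b : G} (hab : a * b ≠ b * a) (k : ℕ) :
    X k ≠ X (k + 1) := by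
  intro heq
  have hstep : ∀ i, X (k + i) = X (k + (i + 1)) := by
    intro i
    induction i with
    | zero => exact heq
    | succ i ih =>
      refine (h.braid (k + (i + 1))).eq_of_commute ?_
      rw [← ih]
      exact h.commute (k + i) 2 le_rfl hn
  have hconst : ∀ i, X (k + i) = X k := by
    intro i
    induction i with
    | zero => rfl
    | succ i ih => rw [← hstep, ih]
  have hper : ∀ j c, X (j + c * n) = X j := by
    intro j c
    induction c with
    | zero => simp
    | succ c ih => rw [Nat.succ_mul, ← add_assoc, h.periodic, ih]
  have hall : ∀ j, X j = X k := by
    intro j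
    have : k ≤ k * n := Nat.le_mul_of_pos_right k (by omega)
    rw [← hper j k, ← hconst (j + k * n - k), Nat.add_sub_cancel' (by omega)]
  have hrange : Set.range X = {X k} := by
    ext g
    constructor
    · rintro ⟨j, rfl⟩
      exact hall j
    · rintro rfl
      exact ⟨k, rfl⟩
  have hc := h.closure_range
  rw [hrange, ← Subgroup.zpowers_eq_closure] at hc
  have hmem : ∀ g : G, g ∈ Subgroup.zpowers (X k) := fun g => hc ▸ Subgroup.mem_top g
  obtain ⟨i, rfl⟩ := hmem a
  obtain ⟨j, rfl⟩ := hmem b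
  exact hab (zpow_mul_comm _ _ _)

end Group

section Perm

variable {n : ℕ} {X : ℕ → Perm (Fin n)}

theorem exists_not_commute (hn : 3 ≤ n) : ∃ a b : Perm (Fin n), a * b ≠ b * a := by
  refine ⟨swap ⟨0, by omega⟩ ⟨1, by omega⟩, swap ⟨1, by omega⟩ ⟨2, by omega⟩, fun h => ?_⟩
  have := congrArg (fun f => f ⟨0, by omega⟩) h
  simp [swap_apply_def] at this

theorem perm_ne_succ (h : BraidCycle n X) (hn : 4 ≤ n) (k : ℕ) : X k ≠ X (k + 1) := by
  obtain ⟨a, b, hab⟩ := exists_not_commute (n := n) (by omega)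
  exact h.ne_succ hn hab k

theorem ne_one (h : BraidCycle n X) (hn : 4 ≤ n) (k : ℕ) : X k ≠ 1 := fun e =>
  h.perm_ne_succ hn k ((h.braid k).eq_of_commute (e ▸ Commute.one_left _))

theorem cycleType_eq (h : BraidCycle n X) (k : ℕ) : (X k).cycleType = (X 0).cycleType :=
  (isConj_iff_cycleType_eq.1 (h.isConj_zero k)).symm

theorem isSwap_of_isSwap_zero (h : BraidCycle n X) (h0 : (X 0).IsSwap) (k : ℕ) :
    (X k).IsSwap := by
  rwa [← card_support_eq_two, ← sum_cycleType, h.cycleType_eq, sum_cycleType,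
    card_support_eq_two]

theorem sign_zero (h : BraidCycle n X) (hn : 2 ≤ n) : sign (X 0) = -1 := by
  rcases Int.units_eq_one_or (sign (X 0)) with h1 | h1
  · exfalso
    have hle : Subgroup.closure (Set.range X) ≤ (sign : Perm (Fin n) →* ℤˣ).ker := by
      rw [Subgroup.closure_le]
      rintro _ ⟨k, rfl⟩
      change sign (X k) = 1
      rw [← h1, sign_of_cycleType, sign_of_cycleType, h.cycleType_eq]
    rw [h.closure_range] at hle
    have : sign (swap (⟨0, by omega⟩ : Fin n) ⟨1, by omega⟩) = 1 := hle (Subgroup.mem_top _)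
    rw [sign_swap (by simp)] at this
    exact absurd this (by decide)
  · exact h1

/-- A generating braid cycle of transpositions is conjugate to the standard one. -/
theorem exists_conj_eq_swap (h : BraidCycle n X) (hn : 4 < n) (hsw : ∀ k, (X k).IsSwap) :
    ∃ e : Perm (Fin n), ∀ x y : Fin n, y.val = (x.val + 1) % n →
      e * X x * e⁻¹ = swap x y := by
  have hdisj : ∀ k, Disjoint (X k) (X (k + 2)) := fun k =>
    disjoint_of_isSwap_of_commute (hsw _) (hsw _) (h.commute k 2 le_rfl (by omega)) fun e =>
      h.perm_ne_succ (by omega) (k + 2)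
        ((h.braid _).eq_of_commute (e ▸ h.commute k 3 (by omega) (by omega)))
  have hmeet : ∀ k, ∃ p, X k p ≠ p ∧ X (k + 1) p ≠ p := by
    intro k
    by_contra! hcon
    have : Disjoint (X k) (X (k + 1)) := fun p => or_iff_not_imp_left.2 (hcon p)
    exact h.perm_ne_succ (by omega) k ((h.braid k).eq_of_commute this.commute)
  have hq : ∀ i : Fin n, ∃ p, X (i + n - 1) p ≠ p ∧ X i p ≠ p := by
    intro i
    obtain ⟨p, hp1, hp2⟩ := hmeet (i + n - 1)
    rw [Nat.sub_add_cancel (by omega), h.periodic] at hp2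
    exact ⟨p, hp1, hp2⟩
  choose q hq1 hq2 using hq
  have hX : ∀ x y : Fin n, y.val = (x.val + 1) % n → X x = swap (q x) (q y) := by
    intro x x' hx'
    have hx : x'.val = x.val + 1 ∨ x'.val = 0 ∧ x.val + 1 = n := by
      rcases Nat.lt_or_ge (x.val + 1) n with hlt | hge
      · exact Or.inl (hx'.trans (Nat.mod_eq_of_lt hlt))
      · have e : x.val + 1 = n := by omega
        exact Or.inr ⟨by simp [hx', e], e⟩
    have e1 : X (x' + n - 1) = X x := by
      rcases hx with e | ⟨e, e'⟩
      · rw [e, show x.val + 1 + n - 1 = x.val + n by omega, h.periodic]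
      · congr 1
        omega
    have e2 : X (x + n - 1 + 2) = X x' := by
      rcases hx with e | ⟨e, e'⟩
      · rw [e, show x.val + n - 1 + 2 = x.val + 1 + n by omega, h.periodic]
      · rw [e, show x.val + n - 1 + 2 = 0 + n + n by omega, h.periodic, h.periodic]
    have hm1 := hq2 x
    have hm2 := hq1 x'
    rw [e1] at hm2
    have hne : q x ≠ q x' := by
      intro e
      rcases hdisj (x + n - 1) (q x) with hd | hd
      · exact hq1 x hd
      · rw [e2, e] at hd
        exact hq2 x' hd
    obtain ⟨a, b, hab, hs⟩ := hsw x
    rw [hs] at hm1 hm2 ⊢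
    rw [← mem_support, support_swap hab] at hm1 hm2
    simp only [Finset.mem_insert, Finset.mem_singleton] at hm1 hm2
    rcases hm1 with h1 | h1 <;> rcases hm2 with h2 | h2
    · exact absurd (h1.trans h2.symm) hne
    · rw [h1, h2]
    · rw [h1, h2, swap_comm]
    · exact absurd (h1.trans h2.symm) hne
  have hper : ∀ k, X k = X (k % n) := by
    intro k
    induction k using Nat.strong_induction_on with
    | _ k ih =>
    rcases Nat.lt_or_ge k n with hlt | hge
    · rw [Nat.mod_eq_of_lt hlt]
    · rw [← Nat.sub_add_cancel hge, h.periodic, Nat.add_mod_right]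
      exact ih _ (by omega)
  have hinv : ∀ g : Perm (Fin n), ∀ p, p ∈ Set.range q → g p ∈ Set.range q := by
    intro g
    have hg : g ∈ Subgroup.closure (Set.range X) := h.closure_range ▸ Subgroup.mem_top g
    rw [← Subgroup.mem_toSubmonoid, Subgroup.closure_toSubmonoid_of_finite] at hg
    induction hg using Submonoid.closure_induction with
    | mem x hx =>
      obtain ⟨k, rfl⟩ := hx
      intro p hp
      have := hX ⟨k % n, Nat.mod_lt _ (by omega)⟩ ⟨_, Nat.mod_lt _ (by omega)⟩ rfl
      rw [hper k]
      simp only at this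
      rw [this, swap_apply_def]
      split_ifs
      exacts [⟨_, rfl⟩, ⟨_, rfl⟩, hp]
    | one => exact fun p hp => hp
    | mul x y _ _ ihx ihy => exact fun p hp => ihx _ (ihy p hp)
  have hsurj : Function.Surjective q := by
    intro b
    have := hinv (swap (q ⟨0, by omega⟩) b) (q ⟨0, by omega⟩) ⟨_, rfl⟩
    rwa [swap_apply_left] at this
  let e : Perm (Fin n) := Equiv.ofBijective q ⟨Finite.injective_iff_surjective.2 hsurj, hsurj⟩
  refine ⟨e⁻¹, fun x y hxy => ?_⟩
  rw [hX x y hxy, mul_swap_eq_swap_mul, mul_inv_cancel_right]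
  congr 1 <;> exact e.symm_apply_apply _

theorem isSwap_zero (h : BraidCycle n X) (hn : 4 < n) (hn6 : n ≠ 6) : (X 0).IsSwap := by
  have h1 := h.ne_one (by omega) 0
  have hne := h.perm_ne_succ (by omega) 2
  rcases Nat.lt_or_ge n 7 with h7 | h7
  · exact (isSwap_of_card_le_five (by rw [Fintype.card_fin]; omega) h1
      (h.commute 0 2 le_rfl (by omega)) (h.commute 0 3 (by omega) (by omega)) (h.braid 2) hne).1
  by_contra hsw
  have hcard := card_fixed_add_card_support (X 0)
  have hsupp := card_support_ge_three h1 hsw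
  rw [Fintype.card_fin] at hcard
  have := ((h.chain (by omega) 2).shift 0 (n - 3) (by omega)).const_of_commute (x := X 0)
    (by omega) (BraidChain.const_of_card_le (n - 3) (by omega))
    (fun i hi => by
      have := h.commute 0 (i + 2) (by omega) (by omega)
      rwa [zero_add] at this) (by omega) (by rw [Fintype.card_fin]; omega) 1 (by omega)
  exact hne this.symm

theorem exists_mulEquiv (h : BraidCycle n X) (hn : 4 < n) :
    ∃ α : Perm (Fin n) ≃* Perm (Fin n), ∀ x y : Fin n, y.val = (x.val + 1) % n →
      α (X x) = swap x y := by
  have of_isSwap : ∀ {Y : ℕ → Perm (Fin n)}, BraidCycle n Y → (Y 0).IsSwap →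
      ∃ α : Perm (Fin n) ≃* Perm (Fin n), ∀ x y : Fin n, y.val = (x.val + 1) % n →
        α (Y x) = swap x y := by
    intro Y hY h0
    obtain ⟨e, he⟩ := hY.exists_conj_eq_swap hn (hY.isSwap_of_isSwap_zero h0)
    exact ⟨MulAut.conj e, he⟩
  by_cases hn6 : n = 6
  · subst hn6
    rcases isSwap_or_cycleType_of_sign (h.sign_zero (by omega)) (h.commute 0 2 le_rfl (by omega))
      (h.commute 0 3 (by omega) (by omega)) (h.braid 2) (h.perm_ne_succ (by omega) 2) with h0 | h0
    · exact of_isSwap h h0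
    · obtain ⟨θ, hθ⟩ := exists_outer_automorphism
      obtain ⟨α, hα⟩ := of_isSwap (h.map θ) (hθ _ h0)
      exact ⟨θ.trans α, hα⟩
  · exact of_isSwap h (h.isSwap_zero hn hn6)

end Perm

end BraidCycle

/-- The images of the generators under a surjective homomorphism `A(Δ_n) → Sym(n)`, extended
periodically, form a generating braid cycle. -/
theorem braidCycle_of_surjective {n : ℕ} (hn : 4 < n)
    (σ : PresentedGroup (cycleRels n) →* Perm (Fin n)) (hσ : Function.Surjective σ) :
    BraidCycle n (fun k => σ (PresentedGroup.of ⟨k % n, Nat.mod_lt _ (Nat.zero_lt_of_lt hn)⟩)) := by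
  set Y : Fin n → Perm (Fin n) := fun i => σ (PresentedGroup.of i) with hY
  let F : FreeGroup (Fin n) →* Perm (Fin n) := σ.comp (PresentedGroup.mk (cycleRels n))
  have hF : ∀ w ∈ cycleRels n, F w = 1 := fun w hw => by
    rw [MonoidHom.comp_apply, PresentedGroup.one_of_mem hw, map_one]
  have hgen : ∀ i (hi : i < n), gen n (i + 1) = FreeGroup.of ⟨i, hi⟩ := by
    intro i hi
    simp [gen, show 0 < n by omega, Nat.mod_eq_of_lt hi]
  have hbr : ∀ i j (hi : i < n) (hj : j < n), i < j → cycEdge n (i + 1) (j + 1) →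
      BR (Y ⟨i, hi⟩) (Y ⟨j, hj⟩) := by
    intro i j hi hj hij hE
    have := hF (braidRel (gen n (i + 1)) (gen n (j + 1)))
      ⟨i + 1, j + 1, by omega, by omega, by omega, Or.inl ⟨hE, rfl⟩⟩
    rw [hgen i hi, hgen j hj] at this
    simp only [braidRel, map_mul, map_inv] at this
    exact mul_inv_eq_one.1 this
  have hcm : ∀ i j (hi : i < n) (hj : j < n), i < j → ¬ cycEdge n (i + 1) (j + 1) →
      Commute (Y ⟨i, hi⟩) (Y ⟨j, hj⟩) := by
    intro i j hi hj hij hE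
    have := hF ⁅gen n (i + 1), gen n (j + 1)⁆
      ⟨i + 1, j + 1, by omega, by omega, by omega, Or.inr ⟨hE, rfl⟩⟩
    rw [hgen i hi, hgen j hj] at this
    rw [map_commutatorElement] at this
    exact commutatorElement_eq_one_iff_mul_comm.1 this
  have hmod : ∀ k j, j < n → (k + j) % n = k % n + j ∧ k % n + j < n ∨
      (k + j) % n + n = k % n + j := by
    intro k j hj
    have hk := Nat.mod_lt k (show 0 < n by omega)
    rw [Nat.add_mod, Nat.mod_eq_of_lt hj]
    rcases Nat.lt_or_ge (k % n + j) n with hlt | hge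
    · exact Or.inl ⟨Nat.mod_eq_of_lt hlt, hlt⟩
    · right
      rw [Nat.mod_eq_sub_mod hge, Nat.mod_eq_of_lt (by omega)]
      omega
  refine ⟨fun k => ?_, fun k => ?_, fun k j h2 hj => ?_, ?_⟩
  · simp
  · have hk := Nat.mod_lt k (show 0 < n by omega)
    rcases hmod k 1 (by omega) with ⟨e, hlt⟩ | e
    · exact hbr _ _ _ _ (by omega) (Or.inl ⟨by omega, by omega, by omega⟩)
    · exact (hbr _ _ _ _ (by omega) (Or.inr ⟨by omega, by omega⟩)).symm
  · have hk := Nat.mod_lt k (show 0 < n by omega)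
    rcases hmod k j (by omega) with ⟨e, hlt⟩ | e
    · exact hcm _ _ _ _ (by omega) (by rintro (h | h) <;> omega)
    · exact (hcm _ _ _ _ (by omega) (by rintro (h | h) <;> omega)).symm
  · have := congrArg (Subgroup.map σ) (PresentedGroup.closure_range_of (cycleRels n))
    rw [MonoidHom.map_closure, Subgroup.map_top_of_surjective _ hσ, ← Set.range_comp] at this
    rw [← this]
    congr 1
    ext g
    constructor
    · rintro ⟨k, rfl⟩
      exact ⟨_, rfl⟩
    · rintro ⟨i, rfl⟩
      exact ⟨i, by simp [Nat.mod_eq_of_lt i.2]⟩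

/-- Proposition 4.1: for `n > 4`, all surjective homomorphisms
`A(Δ_n) → Sym(n)` are equivalent; in particular each is equivalent to the
homomorphism sending `a_i ↦ (i, i+1)` for `1 ≤ i ≤ n-1` and `a_n ↦ (1, n)`
(in our `Fin n` indexing, the generator labelled `x` goes to `swap x (x+1 mod n)`). -/
theorem surjectives_to_symm_equivalent (n : ℕ) (hn : 4 < n) :
    (∀ σ₁ σ₂ : PresentedGroup (cycleRels n) →* Equiv.Perm (Fin n),
      Function.Surjective σ₁ → Function.Surjective σ₂ →
        ∃ α : Equiv.Perm (Fin n) ≃* Equiv.Perm (Fin n), ∀ g, α (σ₁ g) = σ₂ g) ∧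
    (∀ σ : PresentedGroup (cycleRels n) →* Equiv.Perm (Fin n),
      Function.Surjective σ →
        ∃ α : Equiv.Perm (Fin n) ≃* Equiv.Perm (Fin n),
          ∀ x : Fin n, α (σ (PresentedGroup.of x))
            = Equiv.swap x ⟨(x.val + 1) % n, Nat.mod_lt _ (by omega)⟩) := by

  have main : ∀ σ : PresentedGroup (cycleRels n) →* Equiv.Perm (Fin n),
      Function.Surjective σ →
        ∃ α : Equiv.Perm (Fin n) ≃* Equiv.Perm (Fin n),
          ∀ x : Fin n, α (σ (PresentedGroup.of x))
            = Equiv.swap x ⟨(x.val + 1) % n, Nat.mod_lt _ (by omega)⟩ := by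
    intro σ hσ
    obtain ⟨α, hα⟩ := (braidCycle_of_surjective hn σ hσ).exists_mulEquiv hn
    refine ⟨α, fun x => ?_⟩
    rw [← hα x _ rfl]
    simp [Nat.mod_eq_of_lt x.2]
  refine ⟨fun σ₁ σ₂ h₁ h₂ => ?_, main⟩
  obtain ⟨α₁, hα₁⟩ := main σ₁ h₁
  obtain ⟨α₂, hα₂⟩ := main σ₂ h₂
  have hext : α₁.toMonoidHom.comp σ₁ = α₂.toMonoidHom.comp σ₂ :=
    PresentedGroup.ext fun x => (hα₁ x).trans (hα₂ x).symm
  refine ⟨α₁.trans α₂.symm, fun g => ?_⟩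
  rw [MulEquiv.trans_apply, MulEquiv.symm_apply_eq]
  exact DFunLike.congr_fun hext g

end ArtinPaper
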